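/- arXiv:1801.00952 — 4 statements merged into one kernel-verified Lean document; each statement's English description precedes it below -/
import Mathlib

section
/- Let M > 0 and let g, h : ℝ × ℝ → ℝ be continuous functions with |g(x,y)| ≤ M and |h(x,y)| ≤ M for all (x,y). Define f : ℝ × ℝ → ℝ × ℝ by f(x,y) = (x + y + y³·g(x,y), y + y⁴·h(x,y)). Then there exist C > 0 and N₀ ∈ ℕ, depending only on M, such that for every natural number N ≥ N₀ and every initial point (x₀,y₀) with 0 < y₀ ≤ 1/N, the orbit (x_k, y_k) := f^k(x₀, y₀) satisfies |y_k − y₀| < C/N³ and |x_k − x₀ − k·y₀| < C/N² for every k with 0 < k ≤ N. -/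
/-- Along the orbit of `(x, y) ↦ (x + y + y³ g, y + y⁴ h)` with `g, h` bounded by `M`, the deviation
from the linear motion grows at most linearly in time, as long as time stays below `1 / ε`. -/
theorem abs_iterate_sub_le {M ε : ℝ} (hM : 0 < M) (hε : 0 < ε)
    (hMε : 16 * M * ε ≤ 1) {g h : ℝ × ℝ → ℝ} (hg : ∀ p, |g p| ≤ M) (hh : ∀ p, |h p| ≤ M)
    {f : ℝ × ℝ → ℝ × ℝ}
    (hf : ∀ p, f p = (p.1 + p.2 + p.2 ^ 3 * g p, p.2 + p.2 ^ 4 * h p))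
    {x₀ y₀ : ℝ} (hy₀ : 0 < y₀) (hy₀ε : y₀ ≤ ε) (k : ℕ) (hk : k * ε ≤ 1) :
    |(f^[k] (x₀, y₀)).2 - y₀| ≤ 16 * M * ε ^ 4 * k ∧
      |(f^[k] (x₀, y₀)).1 - x₀ - k * y₀| ≤ 24 * M * ε ^ 3 * k := by
  induction k with
  | zero => simp
  | succ k ih =>
    push_cast at hk ⊢
    have hkε : k * ε ≤ 1 := by nlinarith
    obtain ⟨hy, hx⟩ := ih hkε
    rw [Function.iterate_succ_apply', hf]
    set p := f^[k] (x₀, y₀)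
    have hdrift : 16 * M * ε ^ 4 * k ≤ 16 * M * ε ^ 3 := by
      have : 16 * M * ε ^ 3 * (k * ε) ≤ 16 * M * ε ^ 3 * 1 := by gcongr
      linarith
    have hsmall : 16 * M * ε ^ 3 ≤ ε := by
      have h₁ : 16 * M * ε * ε ^ 2 ≤ 1 * ε ^ 2 := by gcongr
      nlinarith
    have hp : |p.2| ≤ 2 * ε := by
      have := abs_add_le (p.2 - y₀) y₀
      rw [sub_add_cancel, abs_of_pos hy₀] at this
      linarith
    have hgp : |p.2 ^ 3 * g p| ≤ 8 * M * ε ^ 3 := by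
      rw [abs_mul, abs_pow]
      calc |p.2| ^ 3 * |g p| ≤ (2 * ε) ^ 3 * M := by gcongr; exact hg p
        _ = 8 * M * ε ^ 3 := by ring
    have hhp : |p.2 ^ 4 * h p| ≤ 16 * M * ε ^ 4 := by
      rw [abs_mul, abs_pow]
      calc |p.2| ^ 4 * |h p| ≤ (2 * ε) ^ 4 * M := by gcongr; exact hh p
        _ = 16 * M * ε ^ 4 := by ring
    simp only [abs_le] at hy hx hgp hhp ⊢
    constructor <;> constructor <;> linarith [hy.1, hy.2, hx.1, hx.2, hgp.1, hgp.2,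
      hhp.1, hhp.2]

/-- Abstract Lazutkin-coordinate orbit estimate (Lemma 2 of the paper):
for the normal form `f (x, y) = (x + y + y³ g (x,y), y + y⁴ h (x,y))` with `g, h`
continuous and bounded by `M`, there are `C > 0` and `N₀`, depending only on `M`,
such that for all `N ≥ N₀` and initial data `0 < y₀ ≤ 1/N`, the orbit
`(x_k, y_k) = f^[k] (x₀, y₀)` satisfies `|y_k − y₀| < C/N³` and
`|x_k − x₀ − k y₀| < C/N²` for all `0 < k ≤ N`. -/
theorem stmt0 (M : ℝ) (hM : 0 < M) :
    ∃ C : ℝ, 0 < C ∧ ∃ N₀ : ℕ,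
      ∀ g h : ℝ × ℝ → ℝ, Continuous g → Continuous h →
        (∀ p : ℝ × ℝ, |g p| ≤ M) → (∀ p : ℝ × ℝ, |h p| ≤ M) →
        ∀ f : ℝ × ℝ → ℝ × ℝ,
          (∀ p : ℝ × ℝ, f p = (p.1 + p.2 + p.2 ^ 3 * g p, p.2 + p.2 ^ 4 * h p)) →
          ∀ N : ℕ, N₀ ≤ N → ∀ x₀ y₀ : ℝ, 0 < y₀ → y₀ ≤ 1 / N →
            ∀ k : ℕ, 0 < k → k ≤ N →
              |(f^[k] (x₀, y₀)).2 - y₀| < C / N ^ 3 ∧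
              |(f^[k] (x₀, y₀)).1 - x₀ - k * y₀| < C / N ^ 2 := by
  obtain ⟨N₀, hN₀⟩ := exists_nat_ge (16 * M + 1)
  refine ⟨25 * M, by positivity, N₀, ?_⟩
  intro g h _ _ hg hh f hf N hN x₀ y₀ hy₀ hy₀N k _ hkN
  have hNM : 16 * M + 1 ≤ (N : ℝ) := hN₀.trans (by exact_mod_cast hN)
  have hNpos : (0 : ℝ) < N := by linarith
  have hkN' : (k : ℝ) * (1 / N) ≤ 1 := by
    rw [mul_one_div, div_le_one hNpos]
    exact_mod_cast hkN
  have hε : (0 : ℝ) < 1 / N := by positivity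
  obtain ⟨hy, hx⟩ := abs_iterate_sub_le hM hε
    (by rw [mul_one_div, div_le_one hNpos]; linarith) hg hh hf (x₀ := x₀) hy₀ hy₀N k hkN'
  rw [div_eq_mul_one_div _ ((N : ℝ) ^ 3), div_eq_mul_one_div _ ((N : ℝ) ^ 2),
    ← one_div_pow, ← one_div_pow]
  set ε : ℝ := 1 / N
  have h₂ : 0 < M * ε ^ 2 := by positivity
  have h₃ : 0 < M * ε ^ 3 := by positivity
  constructor
  · have := mul_le_mul_of_nonneg_left hkN' h₃.le
    linarith
  · have := mul_le_mul_of_nonneg_left hkN' h₂.le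
    linarith
end

section
/- Let M > 0 and let g, h : ℝ × ℝ → ℝ be continuous with |g| ≤ M and |h| ≤ M everywhere, and define f(x,y) = (x + y + y³·g(x,y), y + y⁴·h(x,y)). Fix L > 0 and x₀ ∈ ℝ. For y₀ > 0 write (x_k(y₀), y_k(y₀)) := f^k(x₀, y₀), and define k(y₀) := sup { k ∈ ℕ : x_j(y₀) < x₀ + L for all j ≤ k } whenever this set is bounded. Then for all sufficiently small y₀ > 0 the quantity k(y₀) is finite, and y₀ · k(y₀) → L as y₀ → 0⁺. -/
open Filter

/-- Along an orbit of the normal form, over `O(1 / y)` steps, the angle stays within `O(y ^ 3)` of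
its initial value `y`, and the position stays close to that of the integrable map
`(x, y) ↦ (x + y, y)`. -/
lemma lazutkin_orbit_bounds {M : ℝ} (hM : 0 < M) {g h : ℝ × ℝ → ℝ}
    (hgb : ∀ p : ℝ × ℝ, |g p| ≤ M) (hhb : ∀ p : ℝ × ℝ, |h p| ≤ M)
    {f : ℝ × ℝ → ℝ × ℝ}
    (hf : ∀ p : ℝ × ℝ, f p = (p.1 + p.2 + p.2 ^ 3 * g p, p.2 + p.2 ^ 4 * h p))
    {T y : ℝ} (x₀ : ℝ) (hy : 0 < y) (hsmall : 16 * M * T * y ^ 2 ≤ 1)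
    (j : ℕ) (hj : j * y ≤ T) :
    |(f^[j] (x₀, y)).2 - y| ≤ j * (16 * M * y ^ 4) ∧
      |(f^[j] (x₀, y)).1 - (x₀ + j * y)| ≤ j * ((16 * M * T + 8 * M) * y ^ 3) := by
  induction j with
  | zero => simp
  | succ j ih =>
    push_cast at hj ⊢
    have hjT : j * y ≤ T := by linarith
    obtain ⟨ihy, ihx⟩ := ih hjT
    rw [Function.iterate_succ_apply', hf]
    set p := f^[j] (x₀, y)
    have hdrift : |p.2 - y| ≤ 16 * M * T * y ^ 3 := by
      have := mul_le_mul_of_nonneg_left hjT (by positivity : 0 ≤ 16 * M * y ^ 3)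
      linarith
    have hp : |p.2| ≤ 2 * y := by
      have h1 := mul_le_mul_of_nonneg_right hsmall hy.le
      have h2 := abs_sub_abs_le_abs_sub p.2 y
      rw [abs_of_pos hy] at h2
      linarith
    have hh4 : |p.2 ^ 4 * h p| ≤ 16 * M * y ^ 4 := by
      rw [abs_mul, abs_pow]
      calc |p.2| ^ 4 * |h p| ≤ (2 * y) ^ 4 * M := by gcongr; exact hhb p
        _ = 16 * M * y ^ 4 := by ring
    have hg3 : |p.2 ^ 3 * g p| ≤ 8 * M * y ^ 3 := by
      rw [abs_mul, abs_pow]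
      calc |p.2| ^ 3 * |g p| ≤ (2 * y) ^ 3 * M := by gcongr; exact hgb p
        _ = 8 * M * y ^ 3 := by ring
    rw [abs_le] at ihy ihx hdrift hh4 hg3 ⊢
    rw [abs_le]
    refine ⟨⟨?_, ?_⟩, ?_, ?_⟩ <;> dsimp only <;> linarith

/-- Over `O(1 / y)` steps, the position is within `O(y ^ 2)` of an arithmetic progression. -/
lemma lazutkin_orbit_position_bound {M : ℝ} (hM : 0 < M) {g h : ℝ × ℝ → ℝ}
    (hgb : ∀ p : ℝ × ℝ, |g p| ≤ M) (hhb : ∀ p : ℝ × ℝ, |h p| ≤ M)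
    {f : ℝ × ℝ → ℝ × ℝ}
    (hf : ∀ p : ℝ × ℝ, f p = (p.1 + p.2 + p.2 ^ 3 * g p, p.2 + p.2 ^ 4 * h p))
    {T y : ℝ} (x₀ : ℝ) (hT : 0 < T) (hy : 0 < y) (hsmall : 16 * M * T * y ^ 2 ≤ 1)
    (j : ℕ) (hj : j * y ≤ T) :
    |(f^[j] (x₀, y)).1 - (x₀ + j * y)| ≤ T * (16 * M * T + 8 * M) * y ^ 2 := by
  have h1 := (lazutkin_orbit_bounds hM hgb hhb hf x₀ hy hsmall j hj).2
  have h2 := mul_le_mul_of_nonneg_right hj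
    (by positivity : 0 ≤ (16 * M * T + 8 * M) * y ^ 2)
  linarith

/-- If a sequence stays within `ε` of the progression `x₀ + j * y` as long as `j * y ≤ T`, then
every index up to which it stays below `x₀ + L` is less than `(L + ε) / y`. -/
lemma mul_lt_of_forall_lt_of_abs_sub_le {u : ℕ → ℝ} {x₀ y L T ε : ℝ} (hy : 0 < y)
    (hL : 0 ≤ L + ε) (hT : L + ε + y ≤ T)
    (hu : ∀ j : ℕ, j * y ≤ T → |u j - (x₀ + j * y)| ≤ ε)
    {k : ℕ} (hk : ∀ j ≤ k, u j < x₀ + L) : k * y < L + ε := by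
  by_contra! hc
  have h1 : ⌈(L + ε) / y⌉₊ ≤ k := Nat.ceil_le.2 ((div_le_iff₀ hy).2 hc)
  have h2 := (div_le_iff₀ hy).1 (Nat.le_ceil ((L + ε) / y))
  have h3 := mul_lt_mul_of_pos_right (Nat.ceil_lt_add_one (div_nonneg hL hy.le)) hy
  rw [add_mul, div_mul_cancel₀ _ hy.ne', one_mul] at h3
  have h4 := abs_le.1 (hu _ (h3.le.trans hT))
  linarith [hk _ h1, h4.1]

/-- If a sequence stays within `ε` of the progression `x₀ + j * y` as long as `j * y ≤ T`, then
it stays below `x₀ + L` up to every index less than `(L - ε) / y`. -/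
lemma forall_lt_of_mul_lt_of_abs_sub_le {u : ℕ → ℝ} {x₀ y L T ε : ℝ} (hy : 0 < y)
    (hT : L - ε ≤ T)
    (hu : ∀ j : ℕ, j * y ≤ T → |u j - (x₀ + j * y)| ≤ ε)
    {k : ℕ} (hk : k * y < L - ε) : ∀ j ≤ k, u j < x₀ + L := by
  intro j hj
  have h1 : (j : ℝ) * y ≤ k * y := by gcongr
  have h2 := abs_le.1 (hu j (by linarith))
  linarith [h2.2]

/-- Crossing-time asymptotics (used in the proof of Lemma 1 of the paper):
for the Lazutkin normal form `f (x, y) = (x + y + y³ g (x,y), y + y⁴ h (x,y))`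
with `g, h` continuous and bounded, fix `L > 0` and `x₀`, and for `y₀ > 0` let
`k (y₀)` be the supremum of the set of `k` such that `x_j < x₀ + L` for all
`j ≤ k`, where `(x_j, y_j) = f^[j] (x₀, y₀)`.  Then for all sufficiently small
`y₀ > 0` this set is bounded (so `k (y₀)` is finite), and `y₀ · k (y₀) → L`
as `y₀ → 0⁺`. -/
theorem stmt1 (M : ℝ) (hM : 0 < M) (g h : ℝ × ℝ → ℝ)
    (hg : Continuous g) (hh : Continuous h)
    (hgb : ∀ p : ℝ × ℝ, |g p| ≤ M) (hhb : ∀ p : ℝ × ℝ, |h p| ≤ M)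
    (f : ℝ × ℝ → ℝ × ℝ)
    (hf : ∀ p : ℝ × ℝ, f p = (p.1 + p.2 + p.2 ^ 3 * g p, p.2 + p.2 ^ 4 * h p))
    (L x₀ : ℝ) (hL : 0 < L)
    (S : ℝ → Set ℕ)
    (hS : ∀ y₀ : ℝ, S y₀ = {k : ℕ | ∀ j ≤ k, (f^[j] (x₀, y₀)).1 < x₀ + L}) :
    (∀ᶠ y₀ in nhdsWithin 0 (Set.Ioi 0), BddAbove (S y₀)) ∧
    Tendsto (fun y₀ : ℝ => y₀ * ((sSup (S y₀) : ℕ) : ℝ))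
      (nhdsWithin 0 (Set.Ioi 0)) (nhds L) := by
  set T := L + 1 with hTdef
  have hT : 0 < T := by positivity
  set C := T * (16 * M * T + 8 * M) with hC
  have hC0 : 0 < C := by positivity
  have hlim : ∀ φ : ℝ → ℝ, Continuous φ →
      Tendsto φ (nhdsWithin 0 (Set.Ioi 0)) (nhds (φ 0)) :=
    fun φ hφ => (hφ.tendsto 0).mono_left nhdsWithin_le_nhds
  have hsmall : ∀ᶠ y in nhdsWithin (0 : ℝ) (Set.Ioi 0), 16 * M * T * y ^ 2 < 1 :=
    (hlim (fun y => 16 * M * T * y ^ 2) (by fun_prop)).eventually_lt_const (by simp)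
  have hstep : ∀ᶠ y in nhdsWithin (0 : ℝ) (Set.Ioi 0), C * y ^ 2 + y < 1 :=
    (hlim (fun y => C * y ^ 2 + y) (by fun_prop)).eventually_lt_const (by simp)
  have key : ∀ᶠ y in nhdsWithin (0 : ℝ) (Set.Ioi 0), BddAbove (S y) ∧
      L - C * y ^ 2 - y ≤ y * ((sSup (S y) : ℕ) : ℝ) ∧
      y * ((sSup (S y) : ℕ) : ℝ) ≤ L + C * y ^ 2 := by
    filter_upwards [hsmall, hstep, self_mem_nhdsWithin] with y hy1 hy2 hy
    replace hy : 0 < y := hy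
    have hCy : 0 ≤ C * y ^ 2 := by positivity
    have hu : ∀ j : ℕ, j * y ≤ T → |(f^[j] (x₀, y)).1 - (x₀ + j * y)| ≤ C * y ^ 2 :=
      lazutkin_orbit_position_bound hM hgb hhb hf x₀ hT hy hy1.le
    have hupper : ∀ k ∈ S y, k * y < L + C * y ^ 2 := by
      intro k hk
      rw [hS] at hk
      exact mul_lt_of_forall_lt_of_abs_sub_le hy (by positivity) (by linarith) hu hk
    have hbdd : BddAbove (S y) :=
      ⟨⌈(L + C * y ^ 2) / y⌉₊, fun k hk => by
        exact_mod_cast ((lt_div_iff₀ hy).2 (hupper k hk)).le.trans (Nat.le_ceil _)⟩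
    have hne : (S y).Nonempty := ⟨0, by rw [hS]; simpa using hL⟩
    refine ⟨hbdd, ?_, ?_⟩
    · by_contra! hc
      have hmem : sSup (S y) + 1 ∈ S y := by
        rw [hS y, Set.mem_ofPred_eq, ← hS y]
        refine forall_lt_of_mul_lt_of_abs_sub_le hy (by linarith) hu ?_
        push_cast
        linarith
      exact absurd (le_csSup hbdd hmem) (by simp)
    · linarith [hupper _ (Nat.sSup_mem hne hbdd)]
  refine ⟨key.mono fun y hy => hy.1, ?_⟩
  refine tendsto_of_tendsto_of_tendsto_of_le_of_le' ?_ ?_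
    (key.mono fun y hy => hy.2.1) (key.mono fun y hy => hy.2.2)
  · convert hlim (fun y => L - C * y ^ 2 - y) (by fun_prop) using 2
    ring
  · convert hlim (fun y => L + C * y ^ 2) (by fun_prop) using 2
    ring
end

section
/- Let γ : [0, a] → ℝ² be a C¹ regular curve and let R : ℝ² → ℝ² be an affine isometry satisfying R(γ(t)) = γ(a − t) for all t ∈ [0, a]. Let θ ∈ (0, π/2), let p ≥ 1, and let 0 = t₀ < t₁ < ⋯ < t_p = a/2 be such that ∠(γ'(t₀), γ(t₁) − γ(t₀)) = θ and, for every 1 ≤ i ≤ p − 1, ∠(γ(t_i) − γ(t_{i−1}), γ'(t_i)) = ∠(γ'(t_i), γ(t_{i+1}) − γ(t_i)). Define t_{p+i} := a − t_{p−i} for 1 ≤ i ≤ p. Then the reflection law ∠(γ(t_i) − γ(t_{i−1}), γ'(t_i)) = ∠(γ'(t_i), γ(t_{i+1}) − γ(t_i)) holds for every 1 ≤ i ≤ 2p − 1, and ∠(γ(t_{2p}) − γ(t_{2p−1}), γ'(t_{2p})) = θ. -/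
open Real InnerProductGeometry

/-- A curve that is carried to its own time reversal by an isometry has its tangent directions
reversed by the linear part of that isometry, so angles between chords and tangents are preserved. -/
lemma angle_deriv_chord_of_isometry_reverse {a : ℝ} (ha : 0 < a) {γ : ℝ → ℂ}
    (hγ : Differentiable ℝ γ) {R : ℂ → ℂ} (hR : Isometry R)
    (hsym : ∀ t ∈ Set.Icc (0 : ℝ) a, R (γ t) = γ (a - t))
    {s u : ℝ} (hs : s ∈ Set.Icc (0 : ℝ) a) (hu : u ∈ Set.Icc (0 : ℝ) a) :
    angle (deriv γ (a - s)) (γ (a - u) - γ (a - s)) = angle (deriv γ s) (γ s - γ u) := by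
  let A : ℂ →ᵃⁱ[ℝ] ℂ := hR.affineIsometryOfStrictConvexSpace
  let L : ℂ →ₗᵢ[ℝ] ℂ := A.linearIsometry
  have hA (z : ℂ) : A z = R z := rfl
  have hchord (x y : ℝ) (hx : x ∈ Set.Icc (0 : ℝ) a) (hy : y ∈ Set.Icc (0 : ℝ) a) :
      γ (a - x) - γ (a - y) = L (γ x - γ y) := by
    rw [← hsym x hx, ← hsym y hy, ← hA, ← hA]
    exact (A.map_vsub (γ x) (γ y)).symm
  have hderiv : deriv γ (a - s) = -L (deriv γ s) := by
    have hl : HasDerivWithinAt (fun x => γ (a - x)) (-deriv γ (a - s)) (Set.Icc 0 a) s :=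
      (HasDerivAt.comp_const_sub a s (hγ (a - s)).hasDerivAt).hasDerivWithinAt
    have hr : HasDerivWithinAt (fun x => L (γ x - γ s) + γ (a - s)) (L (deriv γ s))
        (Set.Icc 0 a) s :=
      ((L.toContinuousLinearMap.hasFDerivAt.comp_hasDerivAt s
        ((hγ s).hasDerivAt.sub_const (γ s))).add_const (γ (a - s))).hasDerivWithinAt
    have hr' := hr.congr_of_mem
      (fun x hx => by rw [← hchord x s hx hs, sub_add_cancel]) hs (f₁ := fun x => γ (a - x))
    rw [← (uniqueDiffOn_Icc ha s hs).eq_deriv _ hl hr', neg_neg]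
  rw [hderiv, hchord u s hu hs, ← neg_sub (γ s) (γ u), map_neg, angle_neg_neg, L.angle_map]

/-- Symmetric extension of a half billiard trajectory along a symmetric building
block.  The plane `ℝ²` is identified with `ℂ` (as a real inner product space), and
`angle u v ∈ [0, π]` is the undirected angle between nonzero vectors.  If
`γ : [0, a] → ℂ` is a `C¹` regular curve, `R` is an affine isometry with
`R (γ t) = γ (a − t)`, and `0 = t₀ < t₁ < ⋯ < t_p = a/2` satisfy the entrance
condition `∠(γ' t₀, γ t₁ − γ t₀) = θ` and the reflection law at `t₁, …, t_{p−1}`,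
then setting `t_{p+i} := a − t_{p−i}` the reflection law holds at `t₁, …, t_{2p−1}`
and the exit angle is `∠(γ t_{2p} − γ t_{2p−1}, γ' t_{2p}) = θ`. -/
theorem stmt6 (a : ℝ) (ha : 0 < a) (γ : ℝ → ℂ) (hγ : ContDiff ℝ 1 γ)
    (hreg : ∀ t ∈ Set.Icc (0 : ℝ) a, deriv γ t ≠ 0)
    (R : ℂ → ℂ) (hR : Isometry R)
    (hsym : ∀ t ∈ Set.Icc (0 : ℝ) a, R (γ t) = γ (a - t))
    (θ : ℝ) (hθ : θ ∈ Set.Ioo 0 (π / 2)) (p : ℕ) (hp : 1 ≤ p)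
    (t : ℕ → ℝ) (ht0 : t 0 = 0) (htp : t p = a / 2)
    (hmono : ∀ i < p, t i < t (i + 1))
    (hstart : angle (deriv γ (t 0)) (γ (t 1) - γ (t 0)) = θ)
    (hrefl : ∀ i, 1 ≤ i → i ≤ p - 1 →
      angle (γ (t i) - γ (t (i - 1))) (deriv γ (t i))
        = angle (deriv γ (t i)) (γ (t (i + 1)) - γ (t i)))
    (hext : ∀ i, 1 ≤ i → i ≤ p → t (p + i) = a - t (p - i)) :
    (∀ i, 1 ≤ i → i ≤ 2 * p - 1 →
      angle (γ (t i) - γ (t (i - 1))) (deriv γ (t i))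
        = angle (deriv γ (t i)) (γ (t (i + 1)) - γ (t i))) ∧
    angle (γ (t (2 * p)) - γ (t (2 * p - 1))) (deriv γ (t (2 * p))) = θ := by
  have hle : ∀ i ≤ p, t i ∈ Set.Icc (0 : ℝ) a := by
    have hm : MonotoneOn t (Set.Iic p) := by
      refine monotoneOn_of_le_add_one Set.ordConnected_Iic fun i _ _ hi => ?_
      exact (hmono i (Nat.lt_of_succ_le hi)).le
    intro i hi
    have h0 := hm (Set.mem_Iic.2 (Nat.zero_le p)) (Set.mem_Iic.2 hi) (Nat.zero_le i)
    have h1 := hm (Set.mem_Iic.2 hi) (Set.mem_Iic.2 le_rfl) hi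
    constructor <;> linarith
  have hrev : ∀ i j, i + j = 2 * p → j ≤ p → t i = a - t j := by
    intro i j hij hj
    rcases hj.eq_or_lt with rfl | hj
    · obtain rfl : i = j := by omega
      linarith
    · have h := hext (p - j) (by omega) (by omega)
      rwa [show p + (p - j) = i by omega, show p - (p - j) = j by omega] at h
  have key := fun {s u : ℝ} =>
    angle_deriv_chord_of_isometry_reverse (s := s) (u := u) ha
      (hγ.differentiable one_ne_zero) hR hsym
  have key' : ∀ {s u : ℝ}, s ∈ Set.Icc (0 : ℝ) a → u ∈ Set.Icc (0 : ℝ) a →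
      angle (γ (a - s) - γ (a - u)) (deriv γ (a - s)) = angle (deriv γ s) (γ u - γ s) := by
    intro s u hs hu
    rw [← neg_sub (γ (a - u)), ← neg_sub (γ s), angle_neg_left, angle_neg_right, angle_comm,
      key hs hu]
  refine ⟨fun i hi1 hi2 => ?_, ?_⟩
  · rcases lt_trichotomy i p with hip | rfl | hip
    · exact hrefl i hi1 (by omega)
    · have h := key (hle i le_rfl) (hle (i - 1) (by omega))
      rw [← hrev (i + 1) (i - 1) (by omega) (by omega), ← hrev i i (by omega) le_rfl] at h
      rw [h, angle_comm]
    · obtain ⟨j, hj⟩ : ∃ j, i + j = 2 * p := ⟨2 * p - i, by omega⟩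
      rw [hrev i j hj (by omega), hrev (i - 1) (j + 1) (by omega) (by omega),
        hrev (i + 1) (j - 1) (by omega) (by omega),
        key (hle j (by omega)) (hle (j - 1) (by omega)),
        key' (hle j (by omega)) (hle (j + 1) (by omega)),
        ← hrefl j (by omega) (by omega), angle_comm]
  · rw [hrev (2 * p) 0 (by omega) (by omega), hrev (2 * p - 1) 1 (by omega) hp,
      key' (hle 0 (by omega)) (hle 1 hp), hstart]
end

section
/- Let M > 0, N ∈ ℕ with N ≥ 1, and let y₀ > 0 satisfy 16·M·N·y₀³ ≤ 1. Let (y_k)_{k≥0} be a sequence of nonnegative reals with y_0 = y₀ and |y_{k+1} − y_k| ≤ M·y_k⁴ for all k. Then for every 0 ≤ k ≤ N one has y_k ≤ 2·y₀ and |y_k − y₀| ≤ 16·M·N·y₀⁴. -/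
/-- Discrete Gronwall-type estimate (key step of Lemma 2 of the paper):
if `y_0 = y₀ > 0`, the `y_k` are nonnegative, `|y_{k+1} − y_k| ≤ M y_k⁴` and
`16 M N y₀³ ≤ 1`, then for every `k ≤ N` one has `y_k ≤ 2 y₀` and
`|y_k − y₀| ≤ 16 M N y₀⁴`. -/
theorem stmt11 (M : ℝ) (hM : 0 < M) (N : ℕ) (hN : 1 ≤ N)
    (y₀ : ℝ) (hy₀ : 0 < y₀) (hsmall : 16 * M * N * y₀ ^ 3 ≤ 1)
    (y : ℕ → ℝ) (hpos : ∀ k : ℕ, 0 ≤ y k) (h0 : y 0 = y₀)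
    (hstep : ∀ k : ℕ, |y (k + 1) - y k| ≤ M * (y k) ^ 4) :
    ∀ k ≤ N, y k ≤ 2 * y₀ ∧ |y k - y₀| ≤ 16 * M * N * y₀ ^ 4 := by
  have hlin : ∀ k ≤ N, 16 * M * k * y₀ ^ 4 ≤ 16 * M * N * y₀ ^ 4 := fun k hk => by
    gcongr
  have hle : 16 * M * N * y₀ ^ 4 ≤ y₀ := by
    calc 16 * M * N * y₀ ^ 4 = 16 * M * N * y₀ ^ 3 * y₀ := by ring
      _ ≤ 1 * y₀ := by gcongr
      _ = y₀ := one_mul y₀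
  have hdev : ∀ k ≤ N, |y k - y₀| ≤ 16 * M * k * y₀ ^ 4 := by
    intro k
    induction k with
    | zero => simp [h0]
    | succ k ih =>
      intro hk
      have hkN : k ≤ N := by omega
      have hk_dev := ih hkN
      have hk_le : y k ≤ 2 * y₀ := by
        linarith [le_abs_self (y k - y₀), hlin k hkN]
      have hincr : M * y k ^ 4 ≤ M * (2 * y₀) ^ 4 := by
        have := hpos k
        gcongr
      have htri := abs_sub_le (y (k + 1)) (y k) y₀
      push_cast
      linarith [hstep k]
  intro k hk
  have hbound := (hdev k hk).trans (hlin k hk)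
  exact ⟨by linarith [le_abs_self (y k - y₀)], hbound⟩
end
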